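/- arXiv:1407.2710 — 4 statements merged into one kernel-verified Lean document; each statement's English description precedes it below -/
import Mathlib

section
/- Under the Finito setup, the uniform average of the updated Finito point is a gradient descent step in expectation: (1/n)∑_{j=1}^n w^{(j)} − w = −(1/(αsn)) ∇f(w). -/
open RealInnerProductSpace Finset

/-- The gradient of a scaled finite sum is the scaled sum of the gradients. -/
theorem gradient_const_mul_sum {ι E : Type*} [Fintype ι] [NormedAddCommGroup E]
    [InnerProductSpace ℝ E] [CompleteSpace E] (c : ℝ) {f : ι → E → ℝ} {x : E}
    (hf : ∀ i, DifferentiableAt ℝ (f i) x) :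
    gradient (fun y => c * ∑ i, f i y) x = c • ∑ i, gradient (f i) x := by
  have hsum : DifferentiableAt ℝ (fun y => ∑ i, f i y) x :=
    DifferentiableAt.fun_sum fun i _ => hf i
  simp only [gradient]
  rw [fderiv_const_mul hsum, fderiv_fun_sum fun i _ => hf i]
  simp

/-- The change of an entrywise sum when a single entry is updated. -/
theorem sum_apply_update {ι A E : Type*} [Fintype ι] [DecidableEq ι] [AddCommGroup E]
    (g : ι → A → E) (φ : ι → A) (j : ι) (a : A) :
    ∑ i, g i (Function.update φ j a i) = ∑ i, g i (φ i) + (g j a - g j (φ j)) := by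
  rw [← sub_eq_iff_eq_add', ← Finset.sum_sub_distrib, Finset.sum_eq_single j]
  · simp
  · intro i _ hij
    simp [Function.update_of_ne hij]
  · simp

/-- Under the Finito setup, the uniform average of the updated Finito point is a
gradient descent step in expectation:
`(1/n) ∑ j, w⁽ʲ⁾ - w = -(1/(αsn)) ∇f(w)`. -/
theorem finito_expected_step
    {E : Type*} [NormedAddCommGroup E] [InnerProductSpace ℝ E] [FiniteDimensional ℝ E]
    (n : ℕ) (hn : 1 ≤ n) (f : Fin n → E → ℝ)
    (hdiff : ∀ i, Differentiable ℝ (f i))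
    (F : E → ℝ) (hF : F = fun x => (1/(n:ℝ)) * ∑ i, f i x)
    (s α : ℝ) (hs : 0 < s) (hα : 0 < α)
    (φ : Fin n → E)
    -- the Finito point of an arbitrary table ψ
    (w : (Fin n → E) → E)
    (hw : ∀ ψ : Fin n → E,
      w ψ = ((1/(n:ℝ)) • ∑ i, ψ i)
            - ((1/(α * s * (n:ℝ))) • ∑ i, gradient (f i) (ψ i))) :
    (((1/(n:ℝ)) • ∑ j, w (Function.update φ j (w φ))) - w φ)
      = -((1/(α * s * (n:ℝ))) • gradient F (w φ)) := by
  have hn0 : (n : ℝ) ≠ 0 := by positivity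
  have hstep (j : Fin n) : w (Function.update φ j (w φ)) =
      w φ + ((1/(n:ℝ)) • (w φ - φ j)
        - (1/(α * s * (n:ℝ))) • (gradient (f j) (w φ) - gradient (f j) (φ j))) := by
    rw [hw (Function.update φ j (w φ)), sum_apply_update (fun _ a => a) φ j (w φ),
      sum_apply_update (fun i a => gradient (f i) a) φ j (w φ), smul_add, smul_add]
    nth_rewrite 3 [hw φ]
    abel
  have hgrad : gradient F (w φ) = (1/(n:ℝ)) • ∑ i, gradient (f i) (w φ) := by
    rw [hF, gradient_const_mul_sum _ fun i => hdiff i (w φ)]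
  have hφ := hw φ
  simp_rw [hstep, hgrad]
  simp only [Finset.sum_add_distrib, Finset.sum_sub_distrib, ← Finset.smul_sum,
    Finset.sum_const, Finset.card_univ, Fintype.card_fin, ← Nat.cast_smul_eq_nsmul ℝ]
  generalize ∑ i, gradient (f i) (w φ) = G
  generalize ∑ i, gradient (f i) (φ i) = H at hφ ⊢
  generalize ∑ i, φ i = P at hφ ⊢
  generalize w φ = v at hφ ⊢
  rw [hφ]
  match_scalars <;> field_simp <;> ring
end

section
/- Under the Finito setup, define T4 = (s/(2n))∑_i ‖φ̄ − φ_i‖² and let T4^{(j)} be the same quantity evaluated on the updated table φ^{(j)} (whose mean is φ̄ + (w − φ_j)/n). Then the uniform average over j satisfies the exact identity: (1/n)∑_{j=1}^n T4^{(j)} − T4 = −(s/(2n²))∑_{i=1}^n ‖φ̄ − φ_i‖² + (s/(2n))‖φ̄ − w‖² − (s/(2n³))∑_{i=1}^n ‖w − φ_i‖². -/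
open RealInnerProductSpace Finset

theorem sum_norm_sq_mean_sub {E : Type*} [NormedAddCommGroup E] [InnerProductSpace ℝ E]
    {n : ℕ} (hn : (n : ℝ) ≠ 0) (ψ : Fin n → E) (c : E) :
    ∑ i, ‖((1/(n:ℝ)) • ∑ l, ψ l) - ψ i‖^2
      = ∑ i, ‖ψ i - c‖^2 - n * ‖((1/(n:ℝ)) • ∑ l, ψ l) - c‖^2 := by
  set m := (1/(n:ℝ)) • ∑ l, ψ l with hm
  have hsum : ∑ i, (ψ i - c) = (n:ℝ) • (m - c) := by
    rw [hm, smul_sub, smul_smul, mul_one_div_cancel hn, one_smul, sum_sub_distrib, sum_const,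
      card_univ, Fintype.card_fin, Nat.cast_smul_eq_nsmul]
  have hterm : ∀ i, ‖m - ψ i‖^2 = ‖ψ i - c‖^2 - 2 * inner ℝ (ψ i - c) (m - c) + ‖m - c‖^2 := by
    intro i
    rw [norm_sub_rev, ← norm_sub_sq_real, sub_sub_sub_cancel_right]
  simp only [hterm, sum_add_distrib, sum_sub_distrib, ← mul_sum, ← sum_inner, hsum,
    real_inner_smul_left, real_inner_self_eq_norm_sq, sum_const, card_univ, Fintype.card_fin,
    nsmul_eq_mul]
  ring

theorem sum_comp_update {ι α M : Type*} [Fintype ι] [DecidableEq ι] [AddCommGroup M]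
    (g : α → M) (φ : ι → α) (j : ι) (w : α) :
    ∑ i, g (Function.update φ j w i) = ∑ i, g (φ i) + (g w - g (φ j)) := by
  have h : ∀ i, g (Function.update φ j w i) = Function.update (g ∘ φ) j (g w) i := fun i => by
    rw [← Function.comp_update, Function.comp_apply]
  simp only [h, sum_update_of_mem (mem_univ j), ← Finset.add_sum_erase univ (fun i => g (φ i))
    (mem_univ j), sdiff_singleton_eq_erase, Function.comp_apply]
  abel

/-- The effect of replacing one point of a table on the sum of squared deviations from the mean. -/
theorem sum_norm_sq_mean_sub_update {E : Type*} [NormedAddCommGroup E] [InnerProductSpace ℝ E]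
    {n : ℕ} (hn : (n : ℝ) ≠ 0) (φ : Fin n → E) (j : Fin n) (w : E) :
    ∑ i, ‖((1/(n:ℝ)) • ∑ l, Function.update φ j w l) - Function.update φ j w i‖^2
      = ∑ i, ‖((1/(n:ℝ)) • ∑ l, φ l) - φ i‖^2 + ‖((1/(n:ℝ)) • ∑ l, φ l) - w‖^2
        - ‖((1/(n:ℝ)) • ∑ l, φ l) - φ j‖^2 - 1/(n:ℝ) * ‖w - φ j‖^2 := by
  set m := (1/(n:ℝ)) • ∑ l, φ l with hm
  have hmean : (1/(n:ℝ)) • ∑ l, Function.update φ j w l - m = (1/(n:ℝ)) • (w - φ j) := by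
    have h := sum_comp_update (fun x : E => x) φ j w
    rw [h, smul_add, ← hm, add_sub_cancel_left]
  rw [sum_norm_sq_mean_sub hn _ m, hmean, norm_smul, mul_pow, Real.norm_eq_abs, sq_abs,
    sum_comp_update (fun x => ‖x - m‖^2)]
  simp only [norm_sub_rev _ m]
  field_simp
  ring

/-- Under the Finito setup, with `T4 ψ = (s/(2n)) ∑ᵢ ‖mean ψ - ψᵢ‖²`, the uniform average
over the updated index `j` satisfies the exact identity
`(1/n) ∑ j, T4(φ⁽ʲ⁾) - T4(φ) = -(s/(2n²)) ∑ᵢ ‖φbar - φᵢ‖² + (s/(2n))‖φbar - w‖²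
  - (s/(2n³)) ∑ᵢ ‖w - φᵢ‖²`. -/
theorem finito_T4_change
    {E : Type*} [NormedAddCommGroup E] [InnerProductSpace ℝ E] [FiniteDimensional ℝ E]
    (n : ℕ) (hn : 1 ≤ n) (f : Fin n → E → ℝ)
    (hdiff : ∀ i, Differentiable ℝ (f i))
    (s α : ℝ) (hs : 0 < s) (hα : 0 < α)
    (φ : Fin n → E)
    (φbar : E) (hφbar : φbar = (1/(n:ℝ)) • ∑ i, φ i)
    (w : E) (hw : w = φbar - ((1/(α * s * (n:ℝ))) • ∑ i, gradient (f i) (φ i)))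
    (T4 : (Fin n → E) → ℝ)
    (hT4 : ∀ ψ : Fin n → E,
      T4 ψ = (s/(2 * (n:ℝ))) * ∑ i, ‖((1/(n:ℝ)) • ∑ l, ψ l) - ψ i‖^2) :
    ((1/(n:ℝ)) * ∑ j, T4 (Function.update φ j w)) - T4 φ
      = -(s/(2 * (n:ℝ)^2)) * ∑ i, ‖φbar - φ i‖^2
        + (s/(2 * (n:ℝ))) * ‖φbar - w‖^2
        - (s/(2 * (n:ℝ)^3)) * ∑ i, ‖w - φ i‖^2 := by
  have hn0 : (n : ℝ) ≠ 0 := Nat.cast_ne_zero.mpr (by omega)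
  simp only [hT4, sum_norm_sq_mean_sub_update hn0, ← hφbar, ← mul_sum, sum_sub_distrib,
    sum_add_distrib, sum_const, card_univ, Fintype.card_fin, nsmul_eq_mul]
  field_simp
  ring
end

section
/- (Lyapunov function bounds suboptimality) Under the Finito setup with Lyapunov function T = T1 + T2 + T3 + T4, if α ≥ 1 and w* is a minimizer of f, then f(φ̄) − f(w*) ≤ α T. -/
open RealInnerProductSpace Finset

/-- First-order lower bound for a differentiable strongly convex function. -/
theorem StrongConvexOn.add_inner_gradient_add_le
    {E : Type*} [NormedAddCommGroup E] [InnerProductSpace ℝ E] [CompleteSpace E]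
    {f : E → ℝ} {m : ℝ} (hf : StrongConvexOn Set.univ m f) {x : E}
    (hd : DifferentiableAt ℝ f x) (y : E) :
    f x + ⟪gradient f x, y - x⟫ + m / 2 * ‖y - x‖ ^ 2 ≤ f y := by
  have hconv := (strongConvexOn_iff_convex.1 hf).comp_affineMap (AffineMap.lineMap x y)
  have hline : HasDerivAt (AffineMap.lineMap x y : ℝ → E) (y - x) 0 :=
    AffineMap.hasDerivAt_lineMap
  have hx : (AffineMap.lineMap x y : ℝ → E) 0 = x := AffineMap.lineMap_apply_zero x y
  have hgrad : HasFDerivAt f (InnerProductSpace.toDual ℝ E (gradient f x))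
      ((AffineMap.lineMap x y : ℝ → E) 0) := by
    rw [hx]; exact hd.hasGradientAt.hasFDerivAt
  have hderiv := (hgrad.comp_hasDerivAt 0 hline).sub ((hline.norm_sq).const_mul (m / 2))
  have key := hconv.le_slope_of_hasDerivAt (Set.mem_univ 0) (Set.mem_univ 1) one_pos hderiv
  simp only [slope_def_field, Function.comp_apply, AffineMap.lineMap_apply_zero,
    AffineMap.lineMap_apply_one, InnerProductSpace.toDual_apply_apply, sub_zero, div_one] at key
  have hy : ‖y‖ ^ 2 = ‖x‖ ^ 2 + 2 * ⟪x, y - x⟫ + ‖y - x‖ ^ 2 := by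
    rw [← norm_add_sq_real, add_sub_cancel]
  rw [hy] at key
  linarith

/-- The parallel axis theorem: the sum of squared distances to a point in terms of the centroid. -/
theorem sum_norm_sub_sq_eq_of_sum_sub_eq_zero
    {ι E : Type*} [Fintype ι] [NormedAddCommGroup E] [InnerProductSpace ℝ E]
    {φ : ι → E} {c : E} (hc : ∑ i, (c - φ i) = 0) (z : E) :
    ∑ i, ‖z - φ i‖ ^ 2 = Fintype.card ι * ‖z - c‖ ^ 2 + ∑ i, ‖c - φ i‖ ^ 2 := by
  have h (i : ι) : ‖z - φ i‖ ^ 2 = ‖z - c‖ ^ 2 + 2 * ⟪z - c, c - φ i⟫ + ‖c - φ i‖ ^ 2 := by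
    rw [← norm_add_sq_real, sub_add_sub_cancel]
  simp [h, sum_add_distrib, ← mul_sum, ← inner_sum, hc]

/-- (Lyapunov function bounds suboptimality) Under the Finito setup with Lyapunov
function `T = T1 + T2 + T3 + T4`, if `α ≥ 1` and `w*` minimizes `f`, then
`f(φbar) - f(w*) ≤ α T`. -/
theorem finito_lyapunov_bounds_suboptimality
    {E : Type*} [NormedAddCommGroup E] [InnerProductSpace ℝ E] [FiniteDimensional ℝ E]
    (n : ℕ) (hn : 1 ≤ n) (f : Fin n → E → ℝ)
    (hdiff : ∀ i, Differentiable ℝ (f i))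
    (s : ℝ) (hs : 0 < s)
    (hsc : ∀ i, StrongConvexOn Set.univ s (f i))
    (F : E → ℝ) (hF : F = fun x => (1/(n:ℝ)) * ∑ i, f i x)
    (wstar : E) (hmin : ∀ y, F wstar ≤ F y)
    (α : ℝ) (hα : 1 ≤ α)
    (φ : Fin n → E)
    (φbar : E) (hφbar : φbar = (1/(n:ℝ)) • ∑ i, φ i)
    (w : E) (hw : w = φbar - ((1/(α * s * (n:ℝ))) • ∑ i, gradient (f i) (φ i)))
    (T : ℝ)
    (hT : T = F φbar
        + ((-(1/(n:ℝ)) * ∑ i, f i (φ i))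
            - (1/(n:ℝ)) * ∑ i, ⟪gradient (f i) (φ i), w - φ i⟫)
        + (-(s/(2 * (n:ℝ))) * ∑ i, ‖w - φ i‖^2)
        + (s/(2 * (n:ℝ))) * ∑ i, ‖φbar - φ i‖^2) :
    F φbar - F wstar ≤ α * T := by
  have hN : (0 : ℝ) < n := by exact_mod_cast hn
  have hα0 : 0 < α := one_pos.trans_le hα
  set g : Fin n → E := fun i => gradient (f i) (φ i)
  obtain ⟨d, hd⟩ : ∃ d, d = w - φbar := ⟨_, rfl⟩
  have hG : ∑ i, g i = -((α * s * n) • d) := by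
    rw [hd, hw, sub_sub_cancel_left, smul_neg, neg_neg, smul_smul,
      mul_one_div_cancel (by positivity), one_smul]
  have hcentroid : ∑ i, (φbar - φ i) = 0 := by
    rw [sum_sub_distrib, sum_const, card_univ, Fintype.card_fin, ← Nat.cast_smul_eq_nsmul ℝ,
      hφbar, smul_smul, mul_one_div_cancel hN.ne', one_smul, sub_self]
  have hinner (z : E) : ∑ i, ⟪g i, z - φ i⟫
      = ∑ i, ⟪g i, φbar - φ i⟫ - α * s * n * ⟪d, z - φbar⟫ := by
    have h (i : Fin n) : ⟪g i, z - φ i⟫ = ⟪g i, φbar - φ i⟫ + ⟪g i, z - φbar⟫ := by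
      rw [← inner_add_right, add_comm, sub_add_sub_cancel]
    simp_rw [h]
    rw [sum_add_distrib, ← sum_inner, hG, inner_neg_left, real_inner_smul_left, ← sub_eq_add_neg]
  have hnorm := sum_norm_sub_sq_eq_of_sum_sub_eq_zero hcentroid
  rw [Fintype.card_fin] at hnorm
  have hlower (z : E) : ∑ i, f i (φ i) + ∑ i, ⟪g i, z - φ i⟫ + s / 2 * ∑ i, ‖z - φ i‖ ^ 2
      ≤ n * F z := by
    have hFz : n * F z = ∑ i, f i z := by
      rw [hF, ← mul_assoc, mul_one_div_cancel hN.ne', one_mul]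
    rw [hFz, mul_sum, ← sum_add_distrib, ← sum_add_distrib]
    exact sum_le_sum fun i _ => (hsc i).add_inner_gradient_add_le (hdiff i _) z
  have hV : 0 ≤ s / 2 * ∑ i, ‖φbar - φ i‖ ^ 2 := by positivity
  have hbar := hlower φbar
  have hstar := hlower wstar
  rw [hinner, hnorm] at hstar
  rw [hinner w, hnorm w, ← hd, real_inner_self_eq_norm_sq] at hT
  obtain ⟨A, hA⟩ : ∃ A, A = (∑ i, f i (φ i) + ∑ i, ⟪g i, φbar - φ i⟫) / n := ⟨_, rfl⟩
  have hAn : ∑ i, f i (φ i) + ∑ i, ⟪g i, φbar - φ i⟫ = n * A := by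
    rw [hA, mul_div_cancel₀ _ hN.ne']
  have hTA : T = F φbar - A + (α - 1 / 2) * s * ‖d‖ ^ 2 := by
    rw [hT, hA]; field_simp; ring
  have hbarA : A ≤ F φbar := le_of_mul_le_mul_left (by linarith) hN
  have hsq : 0 ≤ ‖wstar - φbar - α • d‖ ^ 2 := sq_nonneg _
  rw [norm_sub_sq_real, real_inner_smul_right, norm_smul, mul_pow, Real.norm_eq_abs, sq_abs,
    real_inner_comm] at hsq
  have hstarA : A - s / 2 * (α ^ 2 * ‖d‖ ^ 2) ≤ F wstar := by
    refine le_of_mul_le_mul_left ?_ hN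
    have := mul_nonneg (mul_nonneg hN.le (half_pos hs).le) hsq
    linarith
  have h1 : 0 ≤ (α - 1) * (F φbar - A) := mul_nonneg (by linarith) (by linarith)
  have h2 : 0 ≤ (α - 1) * (α * s / 2 * ‖d‖ ^ 2) := mul_nonneg (by linarith) (by positivity)
  rw [hTA]
  linarith
end

section
/- (Convergence rate of Finito, general step size) Suppose α ≥ 2, β ≥ 2, 2/α − 1/α² − β + β/α ≤ 0, and n ≥ βL/s. Initialize the Finito table with all entries equal to a common point x₀ ∈ E, and run the Finito iteration: at each step, given the current table φ, compute w = φ̄ − (1/(αsn))∑_i ∇f_i(φ_i) and replace entry j by w. Then, averaging uniformly over all index sequences σ ∈ {1,…,n}^k of length k, the mean φ̄^{(k)}(σ) of the table after k steps following σ satisfies (1/n^k)∑_{σ∈{1,…,n}^k} f(φ̄^{(k)}(σ)) − f(w*) ≤ (1 − 1/(2α)) · (1/s) · (1 − 1/(αn))^k · ‖∇f(x₀)‖², where w* is a minimizer of f. -/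
open RealInnerProductSpace Finset

section Smoothness

variable {E : Type*} [NormedAddCommGroup E] [InnerProductSpace ℝ E] [CompleteSpace E]
  {f : E → ℝ} {s L : ℝ}

lemma hasDerivAt_comp_add_smul (hf : Differentiable ℝ f) (x v : E) (t : ℝ) :
    HasDerivAt (fun t : ℝ => f (x + t • v)) ⟪gradient f (x + t • v), v⟫ t := by
  have h₁ : HasDerivAt (fun t : ℝ => x + t • v) v t := by
    simpa using ((hasDerivAt_id t).smul_const v).const_add x
  have h₂ := (hf (x + t • v)).hasFDerivAt.comp_hasDerivAt t h₁
  rwa [← inner_gradient_left] at h₂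

/-- First-order characterization of strong convexity. -/
lemma StrongConvexOn.add_inner_gradient_le (hsc : StrongConvexOn Set.univ s f)
    (hf : Differentiable ℝ f) (x v : E) :
    f x + ⟪gradient f x, v⟫ + s / 2 * ‖v‖ ^ 2 ≤ f (x + v) := by
  have hconv : ConvexOn ℝ Set.univ
      (fun t : ℝ => f (x + t • v) - s / 2 * ‖x + t • v‖ ^ 2) := by
    have h := (strongConvexOn_iff_convex.1 hsc).comp_affineMap (AffineMap.lineMap x (x + v))
    refine h.congr fun t _ => ?_
    simp [AffineMap.lineMap_apply, add_comm]
  have hderiv : HasDerivAt (fun t : ℝ => f (x + t • v) - s / 2 * ‖x + t • v‖ ^ 2)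
      (⟪gradient f x, v⟫ - s * ⟪x, v⟫) 0 := by
    have h₁ : HasDerivAt (fun t : ℝ => x + t • v) v 0 := by
      simpa using ((hasDerivAt_id (0 : ℝ)).smul_const v).const_add x
    have h₂ := (hasDerivAt_comp_add_smul hf x v 0).sub (h₁.norm_sq.const_mul (s / 2))
    refine h₂.congr_deriv ?_
    simp only [zero_smul, add_zero]
    ring
  have h := hconv.le_slope_of_hasDerivAt (Set.mem_univ 0) (Set.mem_univ 1) one_pos hderiv
  simp only [slope_def_field, one_smul, zero_smul, add_zero, sub_zero, div_one,
    norm_add_sq_real, inner_zero_right, norm_zero] at h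
  linarith

/-- The descent lemma for functions with Lipschitz gradient. -/
lemma le_add_inner_gradient_of_lipschitz_gradient (hf : Differentiable ℝ f)
    (hlip : ∀ x y, ‖gradient f x - gradient f y‖ ≤ L * ‖x - y‖) (x v : E) :
    f (x + v) ≤ f x + ⟪gradient f x, v⟫ + L / 2 * ‖v‖ ^ 2 := by
  have hd : ∀ t : ℝ, HasDerivAt
      (fun t : ℝ => f (x + t • v) - (t * ⟪gradient f x, v⟫ + L / 2 * ‖v‖ ^ 2 * t ^ 2))
      (⟪gradient f (x + t • v), v⟫ - (⟪gradient f x, v⟫ + L * ‖v‖ ^ 2 * t)) t := by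
    intro t
    have h := (hasDerivAt_comp_add_smul hf x v t).sub
      (((hasDerivAt_id t).mul_const ⟪gradient f x, v⟫).add
        (((hasDerivAt_id t).pow 2).const_mul (L / 2 * ‖v‖ ^ 2)))
    refine h.congr_deriv ?_
    simp
    ring
  have hanti := antitoneOn_of_deriv_nonpos (convex_Ici (0 : ℝ))
    (fun t _ => (hd t).continuousAt.continuousWithinAt)
    (fun t _ => (hd t).differentiableAt.differentiableWithinAt) (fun t ht => by
      rw [interior_Ici, Set.mem_Ioi] at ht
      rw [(hd t).deriv]
      have h₁ := real_inner_le_norm (gradient f (x + t • v) - gradient f x) v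
      have h₂ := hlip (x + t • v) x
      rw [add_sub_cancel_left, norm_smul, Real.norm_of_nonneg ht.le] at h₂
      rw [inner_sub_left] at h₁
      nlinarith [mul_le_mul_of_nonneg_right h₂ (norm_nonneg v)])
  have h := hanti (Set.mem_Ici.2 le_rfl) (Set.mem_Ici.2 zero_le_one) zero_le_one
  simp only [one_smul, zero_smul, add_zero] at h
  linarith

/-- Lower bound on the Bregman divergence of a smooth strongly convex function. -/
lemma StrongConvexOn.norm_sq_gradient_sub_le (hsc : StrongConvexOn Set.univ s f)
    (hf : Differentiable ℝ f) (hL : 0 < L)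
    (hlip : ∀ x y, ‖gradient f x - gradient f y‖ ≤ L * ‖x - y‖) (hs : 0 ≤ s) (x y : E) :
    1 / (2 * L) * ‖gradient f y - gradient f x - s • (y - x)‖ ^ 2 + s / 2 * ‖y - x‖ ^ 2
      ≤ f y - f x - ⟪gradient f x, y - x⟫ := by
  obtain ⟨d, rfl⟩ : ∃ d, y = x + d := ⟨y - x, by abel⟩
  set r := gradient f (x + d) - gradient f x - s • (x + d - x) with hr
  have hgrad : gradient f (x + d) = gradient f x + r + s • d := by
    rw [hr, add_sub_cancel_left]; abel
  have h₁ := hsc.add_inner_gradient_le hf x (d + -((1 / L) • r))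
  have h₂ := le_add_inner_gradient_of_lipschitz_gradient hf hlip (x + d) (-((1 / L) • r))
  rw [hgrad] at h₂
  rw [← add_assoc] at h₁
  rw [add_sub_cancel_left]
  have h := h₁.trans h₂
  simp only [norm_add_sq_real, inner_add_left, inner_add_right, inner_neg_right,
    real_inner_smul_left, real_inner_smul_right, norm_neg, norm_smul, mul_pow,
    real_inner_self_eq_norm_sq, Real.norm_eq_abs, sq_abs] at h
  have h₃ : 0 ≤ s * ((1 / L) ^ 2 * ‖r‖ ^ 2) := by positivity
  have h₄ : L / 2 * ((1 / L) ^ 2 * ‖r‖ ^ 2) = 1 / (2 * L) * ‖r‖ ^ 2 := by field_simp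
  have h₅ : 1 / L * ‖r‖ ^ 2 = 2 * (1 / (2 * L) * ‖r‖ ^ 2) := by field_simp
  linarith

end Smoothness

section TableAverage

variable {n : ℕ} {X V : Type*} [AddCommGroup V] [Module ℝ V]

/-- The average over `i` of `h i` evaluated at the `i`-th entry of a table. -/
noncomputable def tableAvg (h : Fin n → X → V) (ψ : Fin n → X) : V :=
  (1 / (n : ℝ)) • ∑ i, h i (ψ i)

lemma tableAvg_update (h : Fin n → X → V) (ψ : Fin n → X) (j : Fin n) (w : X) :
    tableAvg h (Function.update ψ j w)
      = tableAvg h ψ + (1 / (n : ℝ)) • (h j w - h j (ψ j)) := by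
  have hsum : ∑ i, h i (Function.update ψ j w i) = ∑ i, h i (ψ i) + (h j w - h j (ψ j)) := by
    rw [← sub_eq_iff_eq_add', ← Finset.sum_sub_distrib, Finset.sum_eq_single j]
    · simp
    · intro i _ hij
      simp [hij]
    · simp
  rw [tableAvg, hsum, smul_add, tableAvg]

lemma tableAvg_const (hn : 1 ≤ n) (v : V) (ψ : Fin n → X) :
    tableAvg (fun _ _ => v) ψ = v := by
  have : (n : ℝ) ≠ 0 := by positivity
  simp [tableAvg, ← Nat.cast_smul_eq_nsmul ℝ, smul_smul, this]

lemma tableAvg_add (h₁ h₂ : Fin n → X → V) (ψ : Fin n → X) :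
    tableAvg (fun i x => h₁ i x + h₂ i x) ψ = tableAvg h₁ ψ + tableAvg h₂ ψ := by
  simp [tableAvg, Finset.sum_add_distrib]

lemma tableAvg_sub (h₁ h₂ : Fin n → X → V) (ψ : Fin n → X) :
    tableAvg (fun i x => h₁ i x - h₂ i x) ψ = tableAvg h₁ ψ - tableAvg h₂ ψ := by
  simp [tableAvg, Finset.sum_sub_distrib, smul_sub]

lemma tableAvg_const_mul (c : ℝ) (h : Fin n → X → ℝ) (ψ : Fin n → X) :
    tableAvg (fun i x => c * h i x) ψ = c * tableAvg h ψ := by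
  simp only [tableAvg, ← Finset.mul_sum, smul_eq_mul]
  ring

lemma tableAvg_mono {h₁ h₂ : Fin n → X → ℝ} {ψ ψ' : Fin n → X}
    (h : ∀ i, h₁ i (ψ i) ≤ h₂ i (ψ' i)) : tableAvg h₁ ψ ≤ tableAvg h₂ ψ' := by
  simp only [tableAvg, smul_eq_mul]
  gcongr with i
  exact h i

lemma tableAvg_inner_left {E : Type*} [NormedAddCommGroup E] [InnerProductSpace ℝ E]
    (h : Fin n → X → E) (v : E) (ψ : Fin n → X) :
    tableAvg (fun i x => ⟪h i x, v⟫) ψ = ⟪tableAvg h ψ, v⟫ := by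
  simp only [tableAvg, real_inner_smul_left, sum_inner, smul_eq_mul]

lemma tableAvg_inner_right {E : Type*} [NormedAddCommGroup E] [InnerProductSpace ℝ E]
    (h : Fin n → X → E) (v : E) (ψ : Fin n → X) :
    tableAvg (fun i x => ⟪v, h i x⟫) ψ = ⟪v, tableAvg h ψ⟫ := by
  simp only [tableAvg, real_inner_smul_right, inner_sum, smul_eq_mul]

end TableAverage

section Finito

variable {n : ℕ} {E : Type*} [NormedAddCommGroup E] [InnerProductSpace ℝ E]
  {f : Fin n → E → ℝ} {g : Fin n → E → E} {s L α β : ℝ}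

/-- The Lyapunov function of the Finito iteration: the mean Bregman divergence from the table
entries to the table mean, plus a multiple of the squared norm of the mean table gradient. -/
noncomputable def finitoLyapunov (f : Fin n → E → ℝ) (g : Fin n → E → E) (c : ℝ)
    (ψ : Fin n → E) : ℝ :=
  tableAvg f (fun _ => tableAvg (fun _ x => x) ψ) - tableAvg (fun i x => f i x - ⟪g i x, x⟫) ψ
    - ⟪tableAvg g ψ, tableAvg (fun _ x => x) ψ⟫ + c * ‖tableAvg g ψ‖ ^ 2

lemma tableAvg_le_tableAvg_add (hn : 1 ≤ n) {a : ℝ} {x y : E}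
    (h : ∀ i, f i y ≤ f i x + ⟪g i x, y - x⟫ + a) :
    tableAvg f (fun _ => y)
      ≤ tableAvg f (fun _ => x) + ⟪tableAvg g (fun _ => x), y - x⟫ + a := by
  rw [← tableAvg_inner_left, ← tableAvg_add]
  conv_rhs => rw [← tableAvg_const hn a (fun _ : Fin n => x), ← tableAvg_add]
  exact tableAvg_mono h

lemma add_tableAvg_le_tableAvg (hn : 1 ≤ n) {a : ℝ} {x y : E}
    (h : ∀ i, f i x + ⟪g i x, y - x⟫ + a ≤ f i y) :
    tableAvg f (fun _ => x) + ⟪tableAvg g (fun _ => x), y - x⟫ + a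
      ≤ tableAvg f (fun _ => y) := by
  rw [← tableAvg_inner_left, ← tableAvg_add]
  conv_lhs => rw [← tableAvg_const hn a (fun _ : Fin n => x), ← tableAvg_add]
  exact tableAvg_mono h

lemma finitoLyapunov_update_le (hn : 1 ≤ n) (hs : 0 < s) (hL : 0 < L)
    (hα : 2 ≤ α) (hβ : 2 ≤ β) (hbig : β * L / s ≤ n)
    (hup : ∀ i x y, f i y ≤ f i x + ⟪g i x, y - x⟫ + L / 2 * ‖y - x‖ ^ 2)
    (hbreg : ∀ i x y, 1 / (2 * L) * ‖g i y - g i x - s • (y - x)‖ ^ 2 + s / 2 * ‖y - x‖ ^ 2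
      ≤ f i y - f i x - ⟪g i x, y - x⟫)
    {c : ℝ} (hc : c = (1 / α - 1 / (2 * α ^ 2)) / s) (ψ : Fin n → E) (j : Fin n) (w : E) :
    finitoLyapunov f g c (Function.update ψ j w) ≤ finitoLyapunov f g c ψ
      + (1 / (n : ℝ)) * (⟪tableAvg g (fun _ => tableAvg (fun _ x => x) ψ) - tableAvg g ψ, w - ψ j⟫
        - 1 / α * (f j w - f j (ψ j) - ⟪g j (ψ j), w - ψ j⟫)
        + ⟪g j w - g j (ψ j), w - tableAvg (fun _ x => x) ψ + (2 * c) • tableAvg g ψ⟫) := by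
  have hn' : (0 : ℝ) < n := by exact_mod_cast hn
  have hα' : 0 < α := by linarith
  obtain ⟨d, hd⟩ : ∃ d, w = ψ j + d := ⟨w - ψ j, by abel⟩
  obtain ⟨e, he⟩ : ∃ e, g j w = g j (ψ j) + e := ⟨g j w - g j (ψ j), by abel⟩
  have hD := hbreg j (ψ j) w
  set D := f j w - f j (ψ j) - ⟪g j (ψ j), w - ψ j⟫ with hDdef
  have hD0 : 0 ≤ D := le_trans (by positivity) hD
  have hcurv : L / 2 * ‖d‖ ^ 2 - ⟪e, d⟫ + c * ‖e‖ ^ 2 ≤ L / s * D := by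
    have hc' : c ≤ 1 / (2 * s) := by
      rw [hc, div_le_div_iff₀ hs (by positivity)]
      have : 1 / α ≤ 1 / 2 := by gcongr
      have : 0 ≤ 1 / (2 * α ^ 2) := by positivity
      nlinarith
    rw [he, hd, add_sub_cancel_left, add_sub_cancel_left, norm_sub_sq_real,
      real_inner_smul_right, norm_smul, mul_pow, Real.norm_eq_abs, sq_abs] at hD
    have h₁ := mul_le_mul_of_nonneg_left hD (by positivity : 0 ≤ L / s)
    have h₂ : L / s * (1 / (2 * L) * (‖e‖ ^ 2 - 2 * (s * ⟪e, d⟫) + s ^ 2 * ‖d‖ ^ 2)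
        + s / 2 * ‖d‖ ^ 2)
        = 1 / (2 * s) * ‖e‖ ^ 2 - ⟪e, d⟫ + s / 2 * ‖d‖ ^ 2 + L / 2 * ‖d‖ ^ 2 := by
      field_simp
    have h₃ := mul_le_mul_of_nonneg_right hc' (sq_nonneg ‖e‖)
    have h₄ : 0 ≤ s / 2 * ‖d‖ ^ 2 := by positivity
    linarith
  have hstep : 1 / (n : ℝ) * (L / 2 * ‖d‖ ^ 2 - ⟪e, d⟫ + c * ‖e‖ ^ 2) ≤ (1 - 1 / α) * D := by
    have h₁ : 1 / (n : ℝ) * (L / s) ≤ 1 - 1 / α := by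
      have h₂ : 1 / α ≤ 1 / 2 := by gcongr
      rw [one_div, inv_mul_le_iff₀ hn']
      have h₃ : 2 * (L / s) ≤ n := by
        refine le_trans ?_ hbig
        rw [mul_div_assoc]
        gcongr
      nlinarith
    calc _ ≤ 1 / (n : ℝ) * (L / s * D) := by gcongr
      _ = 1 / (n : ℝ) * (L / s) * D := by ring
      _ ≤ _ := by gcongr
  have hF := tableAvg_le_tableAvg_add hn (x := tableAvg (fun _ x => x) ψ)
    (y := tableAvg (fun _ x => x) (Function.update ψ j w)) fun i => hup i _ _
  have hfw : f j w = D + f j (ψ j) + ⟪g j (ψ j), d⟫ := by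
    linarith [show ⟪g j (ψ j), d⟫ = ⟪g j (ψ j), w - ψ j⟫ by rw [hd, add_sub_cancel_left]]
  simp only [finitoLyapunov]
  rw [tableAvg_update (fun (_ : Fin n) (x : E) => x)] at hF ⊢
  rw [tableAvg_update, tableAvg_update g, hfw, he]
  rw [add_sub_cancel_left] at hF
  have hε := mul_le_mul_of_nonneg_left hstep (by positivity : 0 ≤ 1 / (n : ℝ))
  clear_value D
  subst hd
  simp only [smul_eq_mul, add_sub_cancel_left, norm_add_sq_real, inner_add_left, inner_add_right,
    inner_sub_left, inner_sub_right, real_inner_smul_left, real_inner_smul_right, norm_smul,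
    mul_pow, Real.norm_eq_abs, sq_abs] at hF ⊢
  rw [real_inner_comm e (tableAvg g ψ)]
  linarith

lemma sum_finitoLyapunov_update_le (hn : 1 ≤ n) (hs : 0 < s) (hL : 0 < L)
    (hα : 2 ≤ α) (hβ : 2 ≤ β) (hbig : β * L / s ≤ n)
    (hlow : ∀ i x y, f i x + ⟪g i x, y - x⟫ + s / 2 * ‖y - x‖ ^ 2 ≤ f i y)
    (hup : ∀ i x y, f i y ≤ f i x + ⟪g i x, y - x⟫ + L / 2 * ‖y - x‖ ^ 2)
    (hbreg : ∀ i x y, 1 / (2 * L) * ‖g i y - g i x - s • (y - x)‖ ^ 2 + s / 2 * ‖y - x‖ ^ 2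
      ≤ f i y - f i x - ⟪g i x, y - x⟫)
    {c : ℝ} (hc : c = (1 / α - 1 / (2 * α ^ 2)) / s) (ψ : Fin n → E) {w : E}
    (hw : w = tableAvg (fun _ x => x) ψ - (1 / (α * s)) • tableAvg g ψ) :
    ∑ j, finitoLyapunov f g c (Function.update ψ j w)
      ≤ (n - 1 / α) * finitoLyapunov f g c ψ := by
  have hα' : 0 < α := by linarith
  set m := tableAvg (fun (_ : Fin n) (x : E) => x) ψ with hm
  set γ := tableAvg g ψ with hγ
  set u := w - m with hu
  have hγu : γ = -((α * s) • u) := by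
    rw [hu, hw, sub_sub_cancel_left, smul_neg, neg_neg, smul_smul,
      mul_one_div_cancel (by positivity), one_smul]
  have hwm : w = m + u := by rw [hu]; abel
  have hsum := Finset.sum_le_sum fun j (_ : j ∈ Finset.univ) =>
    finitoLyapunov_update_le hn hs hL hα hβ hbig hup hbreg hc ψ j w
  rw [Finset.sum_add_distrib, Finset.sum_const, Finset.card_univ, Fintype.card_fin,
    nsmul_eq_mul, ← Finset.mul_sum] at hsum
  have havg (G : E) : 1 / (n : ℝ) * ∑ j, (⟪G - γ, w - ψ j⟫
        - 1 / α * (f j w - f j (ψ j) - ⟪g j (ψ j), w - ψ j⟫)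
        + ⟪g j w - g j (ψ j), w - m + (2 * c) • γ⟫)
      = ⟪G - γ, u⟫
        - 1 / α * (tableAvg f (fun _ => w) - tableAvg (fun i x => f i x - ⟪g i x, x⟫) ψ - ⟪γ, w⟫)
        + ⟪tableAvg g (fun _ => w) - γ, u + (2 * c) • γ⟫ := by
    have h₁ : tableAvg (fun _ x => w - x) ψ = u := by
      rw [tableAvg_sub, tableAvg_const hn]
    have h₂ : tableAvg (fun i x => g i w - g i x) ψ = tableAvg g (fun _ => w) - γ := by
      rw [tableAvg_sub]; rfl
    have h₃ : tableAvg (fun i x => f i w - (f i x - ⟪g i x, x⟫) - ⟪g i x, w⟫) ψ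
        = tableAvg f (fun _ => w) - tableAvg (fun i x => f i x - ⟪g i x, x⟫) ψ - ⟪γ, w⟫ := by
      rw [tableAvg_sub, tableAvg_sub, tableAvg_inner_left]; rfl
    rw [← h₁, ← h₂, ← h₃, ← tableAvg_inner_left, ← tableAvg_inner_right, ← tableAvg_const_mul,
      ← tableAvg_sub, ← tableAvg_add, h₁, tableAvg, smul_eq_mul]
    congr 1
    refine Finset.sum_congr rfl fun j _ => ?_
    rw [inner_sub_right (g j (ψ j))]
    ring
  rw [havg, ← hm] at hsum
  refine hsum.trans ?_
  have hF₁ := add_tableAvg_le_tableAvg hn (x := m) (y := w) fun i => hlow i m w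
  have hF₂ := add_tableAvg_le_tableAvg hn (x := w) (y := m) fun i => hlow i w m
  have hV : finitoLyapunov f g c ψ = tableAvg f (fun _ => m)
      - tableAvg (fun i x => f i x - ⟪g i x, x⟫) ψ - ⟪γ, m⟫ + c * ‖γ‖ ^ 2 := rfl
  clear_value u m γ
  generalize tableAvg g (fun _ => m) = G at *
  generalize tableAvg g (fun _ => w) = H at *
  generalize tableAvg (fun i x => f i x - ⟪g i x, x⟫) ψ = A at *
  generalize tableAvg f (fun _ => m) = F₀ at *
  generalize tableAvg f (fun _ => w) = F₁ at *
  have hwm_sub : w - m = u := hu.symm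
  have hmw_sub : m - w = -u := by rw [hu]; abel
  rw [hwm_sub] at hF₁
  rw [hmw_sub, inner_neg_right, norm_neg] at hF₂
  have hαa : α * (1 / α) = 1 := mul_one_div_cancel hα'.ne'
  have ha : 1 / α ≤ 1 := by rw [div_le_one hα']; linarith
  have ha0 : 0 ≤ 1 / α := by positivity
  have hcs : c * (α * s) = 1 - 1 / α / 2 := by
    rw [hc]; field_simp
  rw [sub_mul, hV, hwm, hγu]
  simp only [inner_add_right, inner_neg_left, inner_neg_right, inner_sub_left,
    smul_neg, real_inner_smul_left, real_inner_smul_right, norm_neg, norm_smul, mul_pow,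
    Real.norm_eq_abs, sq_abs, real_inner_self_eq_norm_sq]
  generalize 1 / α = a at *
  have i₁ := mul_le_mul_of_nonneg_left (add_le_add hF₁ hF₂) (sub_nonneg.2 ha)
  have i₂ := mul_le_mul_of_nonneg_left hF₁ ha0
  have t₁ : c * (α * s * ⟪H, u⟫) = (1 - a / 2) * ⟪H, u⟫ := by rw [← hcs]; ring
  have t₂ : c * (α ^ 2 * s ^ 2 * ‖u‖ ^ 2) = (α - 1 / 2) * s * ‖u‖ ^ 2 := by
    linear_combination α * s * ‖u‖ ^ 2 * hcs - s * ‖u‖ ^ 2 / 2 * hαa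
  have t₃ : a * (α * s * ⟪u, m⟫) = s * ⟪u, m⟫ := by linear_combination s * ⟪u, m⟫ * hαa
  have t₄ : a * (α * s * ‖u‖ ^ 2) = s * ‖u‖ ^ 2 := by linear_combination s * ‖u‖ ^ 2 * hαa
  rw [mul_assoc 2 c, mul_assoc 2 c, t₁, t₂]
  linarith

lemma tableAvg_sub_le_mul_finitoLyapunov (hn : 1 ≤ n) (hs : 0 < s) (hα : 2 ≤ α)
    (hlow : ∀ i x y, f i x + ⟪g i x, y - x⟫ + s / 2 * ‖y - x‖ ^ 2 ≤ f i y)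
    {c : ℝ} (hc : c = (1 / α - 1 / (2 * α ^ 2)) / s) (ψ : Fin n → E) (y : E) :
    tableAvg f (fun _ => tableAvg (fun _ x => x) ψ) - tableAvg f (fun _ => y)
      ≤ α * finitoLyapunov f g c ψ := by
  have hα' : 0 < α := by linarith
  set m := tableAvg (fun (_ : Fin n) (x : E) => x) ψ with hm
  have hV : finitoLyapunov f g c ψ = tableAvg f (fun _ => m)
      - tableAvg (fun i x => f i x - ⟪g i x, x⟫) ψ - ⟪tableAvg g ψ, m⟫
      + c * ‖tableAvg g ψ‖ ^ 2 := rfl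
  have hB : 0 ≤ tableAvg f (fun _ => m)
      - tableAvg (fun i x => f i x - ⟪g i x, x⟫) ψ - ⟪tableAvg g ψ, m⟫ := by
    rw [sub_sub, sub_nonneg, ← tableAvg_inner_left, ← tableAvg_add]
    refine tableAvg_mono fun i => ?_
    have h := hlow i (ψ i) m
    have h' : 0 ≤ s / 2 * ‖m - ψ i‖ ^ 2 := by positivity
    rw [inner_sub_right] at h
    linarith
  have hY : tableAvg (fun i x => f i x - ⟪g i x, x⟫) ψ + ⟪tableAvg g ψ, y⟫
      + s / 2 * ‖y - m‖ ^ 2 ≤ tableAvg f (fun _ => y) := by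
    have h₁ : tableAvg (fun i x => f i x - ⟪g i x, x⟫ + ⟪g i x, y⟫
        + (s / 2 * ‖y - m‖ ^ 2 - s * ⟪y - m, x - m⟫)) ψ ≤ tableAvg f (fun _ => y) := by
      refine tableAvg_mono fun i => ?_
      have h := hlow i (ψ i) y
      rw [inner_sub_right, ← sub_sub_sub_cancel_right y (ψ i) m, norm_sub_sq_real] at h
      have h' : 0 ≤ s / 2 * ‖ψ i - m‖ ^ 2 := by positivity
      linarith
    have h₂ : tableAvg (fun _ x => x - m) ψ = 0 := by
      rw [tableAvg_sub, tableAvg_const hn, ← hm, sub_self]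
    rwa [tableAvg_add, tableAvg_add, tableAvg_inner_left,
      tableAvg_sub (fun _ _ => s / 2 * ‖y - m‖ ^ 2),
      tableAvg_const hn, tableAvg_const_mul, tableAvg_inner_right, h₂, inner_zero_right, mul_zero,
      sub_zero] at h₁
  have hsq : 0 ≤ 1 / (2 * s) * ‖tableAvg g ψ + s • (y - m)‖ ^ 2 := by positivity
  have hexp : 1 / (2 * s) * ‖tableAvg g ψ + s • (y - m)‖ ^ 2
      = 1 / (2 * s) * ‖tableAvg g ψ‖ ^ 2 + (⟪tableAvg g ψ, y⟫ - ⟪tableAvg g ψ, m⟫)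
        + s / 2 * ‖y - m‖ ^ 2 := by
    rw [norm_add_sq_real, real_inner_smul_right, inner_sub_right, norm_smul, mul_pow,
      Real.norm_eq_abs, sq_abs]
    field_simp
  have hcα : 1 / (2 * s) ≤ α * c := by
    have h₁ : α * c = (1 - 1 / (2 * α)) / s := by rw [hc]; field_simp
    have h₂ : 1 / (2 * α) ≤ 1 / 2 := by gcongr; linarith
    rw [h₁, ← div_div]
    gcongr
    linarith
  rw [hV]
  nlinarith [mul_le_mul_of_nonneg_right hcα (sq_nonneg ‖tableAvg g ψ‖)]

lemma finitoLyapunov_const (hn : 1 ≤ n) (c : ℝ) (x : E) :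
    finitoLyapunov f g c (fun _ => x) = c * ‖tableAvg g (fun _ => x)‖ ^ 2 := by
  have h : tableAvg (fun (_ : Fin n) (x : E) => x) (fun _ => x) = x :=
    tableAvg_const hn x (fun _ : Fin n => x)
  rw [finitoLyapunov, h, tableAvg_sub, ← tableAvg_inner_left]
  simp only [tableAvg]
  ring

end Finito

lemma sum_foldl_ofFn_le {X ι : Type*} [Fintype ι] {V : X → ℝ} {r : ℝ} (hr : 0 ≤ r)
    {step : X → ι → X} (h : ∀ x, ∑ j, V (step x j) ≤ r * V x) (k : ℕ) (x : X) :
    ∑ σ : Fin k → ι, V ((List.ofFn σ).foldl step x) ≤ r ^ k * V x := by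
  induction k generalizing x with
  | zero => simp
  | succ k ih =>
    rw [← (Fin.consEquiv fun _ => ι).sum_comp, Fintype.sum_prod_type]
    calc _ = ∑ j, ∑ σ : Fin k → ι, V ((List.ofFn σ).foldl step (step x j)) := by
          simp [Fin.consEquiv]
      _ ≤ ∑ j, r ^ k * V (step x j) := Finset.sum_le_sum fun j _ => ih _
      _ = r ^ k * ∑ j, V (step x j) := by rw [Finset.mul_sum]
      _ ≤ r ^ k * (r * V x) := by gcongr; exact h x
      _ = r ^ (k + 1) * V x := by ring


/-- (Convergence rate of Finito, general step size) Starting from the all-`x₀` table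
and applying the Finito iteration `k` times along an index sequence `σ`, the average
over all `σ ∈ {1,…,n}ᵏ` of `f` at the table mean satisfies
`(1/nᵏ) ∑_σ f(φbar⁽ᵏ⁾(σ)) - f(w*) ≤ (1 - 1/(2α)) (1/s) (1 - 1/(αn))ᵏ ‖∇f(x₀)‖²`. -/
theorem finito_convergence_rate
    {E : Type*} [NormedAddCommGroup E] [InnerProductSpace ℝ E] [FiniteDimensional ℝ E]
    (n : ℕ) (hn : 1 ≤ n) (f : Fin n → E → ℝ)
    (hdiff : ∀ i, Differentiable ℝ (f i))
    (s : ℝ) (hs : 0 < s)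
    (hsc : ∀ i, StrongConvexOn Set.univ s (f i))
    (L : ℝ) (hL : 0 < L)
    (hlip : ∀ i, ∀ x y : E, ‖gradient (f i) x - gradient (f i) y‖ ≤ L * ‖x - y‖)
    (F : E → ℝ) (hF : F = fun x => (1/(n:ℝ)) * ∑ i, f i x)
    (wstar : E) (hmin : ∀ y, F wstar ≤ F y)
    (α β : ℝ) (hα : 2 ≤ α) (hβ : 2 ≤ β)
    (hcond : 2/α - 1/α^2 - β + β/α ≤ 0)
    (hbig : (n:ℝ) ≥ β * L / s)
    (x₀ : E) (k : ℕ)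
    -- one step of the Finito iteration: replace entry `j` by the Finito point
    (step : (Fin n → E) → Fin n → (Fin n → E))
    (hstep : ∀ (ψ : Fin n → E) (j : Fin n),
      step ψ j = Function.update ψ j
        (((1/(n:ℝ)) • ∑ i, ψ i)
          - ((1/(α * s * (n:ℝ))) • ∑ i, gradient (f i) (ψ i)))) :
    ((1/(n:ℝ)^k) * ∑ σ : Fin k → Fin n,
        F ((1/(n:ℝ)) • ∑ i, (List.ofFn σ).foldl step (fun _ => x₀) i)) - F wstar
      ≤ (1 - 1/(2*α)) * (1/s) * (1 - 1/(α * (n:ℝ)))^k * ‖gradient F x₀‖^2 := by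
  have hn' : (0 : ℝ) < n := by exact_mod_cast hn
  have hα' : 0 < α := by linarith
  set g : Fin n → E → E := fun i => gradient (f i) with hg
  set c := (1 / α - 1 / (2 * α ^ 2)) / s with hc
  have hFavg (x : E) : F x = tableAvg f (fun _ => x) := by
    rw [hF]; rfl
  have hgrad : gradient F x₀ = tableAvg g (fun _ => x₀) := by
    refine HasGradientAt.gradient ?_
    rw [hasGradientAt_iff_hasFDerivAt, hF]
    have h := (HasFDerivAt.fun_sum fun i (_ : i ∈ Finset.univ) =>
      (hdiff i x₀).hasGradientAt.hasFDerivAt).const_mul (1 / (n : ℝ))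
    simpa [tableAvg, hg] using h
  have hlow (i : Fin n) (x y : E) :
      f i x + ⟪g i x, y - x⟫ + s / 2 * ‖y - x‖ ^ 2 ≤ f i y := by
    simpa only [add_sub_cancel] using (hsc i).add_inner_gradient_le (hdiff i) x (y - x)
  have hup (i : Fin n) (x y : E) :
      f i y ≤ f i x + ⟪g i x, y - x⟫ + L / 2 * ‖y - x‖ ^ 2 := by
    simpa only [add_sub_cancel] using
      le_add_inner_gradient_of_lipschitz_gradient (hdiff i) (hlip i) x (y - x)
  have hbreg (i : Fin n) (x y : E) :=
    (hsc i).norm_sq_gradient_sub_le (hdiff i) hL (hlip i) hs.le x y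
  have hr : 0 ≤ n - 1 / α := by
    have h₁ : 1 / α ≤ 1 := by rw [div_le_one hα']; linarith
    have h₂ : (1 : ℝ) ≤ n := by exact_mod_cast hn
    linarith
  have hcontract (ψ : Fin n → E) :
      ∑ j, finitoLyapunov f g c (step ψ j) ≤ (n - 1 / α) * finitoLyapunov f g c ψ := by
    simp only [hstep]
    refine sum_finitoLyapunov_update_le hn hs hL hα hβ hbig hlow hup hbreg hc ψ ?_
    rw [tableAvg, tableAvg, smul_smul, one_div_mul_one_div]
  have hsum := sum_foldl_ofFn_le hr hcontract k (fun _ => x₀)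
  rw [finitoLyapunov_const hn, ← hgrad] at hsum
  have hgap (ψ : Fin n → E) :
      F ((1 / (n : ℝ)) • ∑ i, ψ i) ≤ α * finitoLyapunov f g c ψ + F wstar := by
    rw [hFavg, hFavg, ← sub_le_iff_le_add]
    exact tableAvg_sub_le_mul_finitoLyapunov hn hs hα hlow hc ψ wstar
  have hle := Finset.sum_le_sum fun (σ : Fin k → Fin n) (_ : σ ∈ Finset.univ) =>
    hgap ((List.ofFn σ).foldl step (fun _ => x₀))
  rw [Finset.sum_add_distrib, ← Finset.mul_sum, Finset.sum_const, Finset.card_univ,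
    Fintype.card_fun, Fintype.card_fin, Fintype.card_fin, nsmul_eq_mul, Nat.cast_pow] at hle
  have hrate : (1 - 1 / (α * (n : ℝ))) ^ k = (n - 1 / α) ^ k / (n : ℝ) ^ k := by
    rw [← div_pow]
    congr 1
    field_simp
  have hcα : (1 - 1 / (2 * α)) * (1 / s) = α * c := by
    rw [hc]; field_simp
  rw [sub_le_iff_le_add, one_div_mul_eq_div, div_le_iff₀ (by positivity), hrate, hcα]
  calc _ ≤ _ := hle
    _ ≤ α * ((n - 1 / α) ^ k * (c * ‖gradient F x₀‖ ^ 2)) + n ^ k * F wstar := by gcongr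
    _ = _ := by field_simp
end
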